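/- Let ℬ = {(x^b_α)_{α∈A}}_{b∈B} and 𝒞 = {(x^c_α)_{α∈A}}_{c∈C} be nonempty families of nets in a vector lattice E indexed by the same directed set A. If ℬ collectively uo-converges to 0 and 𝒞 collectively uo-converges to 0, then both the union family ℬ ∪ 𝒞 = {(x^d_α)_{α∈A}}_{d∈B∪C} and the sum family ℬ + 𝒞 = {(x^b_α + x^c_α)_{α∈A} : b ∈ B, c ∈ C} collectively uo-converge to 0. -/

import Mathlib

universe uJ uA uB uE uF

section Defs

variable {E : Type uE} [Lattice E] [AddCommGroup E]

/-- `le` is a directed preorder (given as a raw relation) on a nonempty index type. -/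
def IsDirPre {J : Type uJ} (le : J → J → Prop) : Prop :=
  Nonempty J ∧ (∀ j, le j j) ∧ (∀ a b c, le a b → le b c → le a c) ∧
    ∀ a b, ∃ c, le a c ∧ le b c

/-- The net `g : J → E` is decreasing with infimum `0` (w.r.t. `le`): `g ↓ 0`. -/
def DownTo0 {J : Type uJ} (le : J → J → Prop) (g : J → E) : Prop :=
  (∀ j₁ j₂, le j₁ j₂ → g j₂ ≤ g j₁) ∧ IsGLB (Set.range g) (0 : E)

/-- The family of nets `x : B → A → E` collectively order converges to `0`:
there is a net `g ↓ 0` such that for every index `j` there is `α₀` with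
`|x b α| ≤ g j` for all `α ≥ α₀` and all `b`. -/
def CoOConv0 {A : Type uA} [Preorder A] {B : Type uB} (x : B → A → E) : Prop :=
  ∃ (J : Type uJ) (le : J → J → Prop) (g : J → E),
    IsDirPre le ∧ DownTo0 le g ∧
      ∀ j : J, ∃ α₀ : A, ∀ (b : B) (α : A), α₀ ≤ α → |x b α| ≤ g j

/-- The family of nets `x : B → A → E` collectively uo-converges to `0`. -/
def CoUoConv0 {A : Type uA} [Preorder A] {B : Type uB} (x : B → A → E) : Prop :=
  ∀ w : E, 0 ≤ w → CoOConv0.{uJ} (fun b α => |x b α| ⊓ w)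

end Defs

universe uC uD

section VectorLattice

variable {E : Type uE} [Lattice E] [AddCommGroup E]

theorem DownTo0.nonneg {J : Type uJ} {r : J → J → Prop} {g : J → E} (hg : DownTo0 r g)
    (j : J) : 0 ≤ g j :=
  hg.2.1 ⟨j, rfl⟩

variable [AddLeftMono E]

theorem add_inf_le_inf_add_inf {a b w : E} (ha : 0 ≤ a) (hb : 0 ≤ b) (hw : 0 ≤ w) :
    (a + b) ⊓ w ≤ a ⊓ w + b ⊓ w := by
  rw [inf_add, add_inf, add_inf]
  exact le_inf (le_inf inf_le_left (inf_le_right.trans (le_add_of_nonneg_left ha)))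
    (le_inf (inf_le_right.trans (le_add_of_nonneg_right hb))
      (inf_le_right.trans (le_add_of_nonneg_left hw)))

theorem IsDirPre.prod {J K : Type uJ} {r : J → J → Prop} {s : K → K → Prop}
    (hr : IsDirPre r) (hs : IsDirPre s) :
    IsDirPre fun p q : J × K => r p.1 q.1 ∧ s p.2 q.2 := by
  obtain ⟨⟨j⟩, hr₁, hr₂, hr₃⟩ := hr
  obtain ⟨⟨k⟩, hs₁, hs₂, hs₃⟩ := hs
  refine ⟨⟨(j, k)⟩, fun p => ⟨hr₁ _, hs₁ _⟩,
    fun a b c hab hbc => ⟨hr₂ _ _ _ hab.1 hbc.1, hs₂ _ _ _ hab.2 hbc.2⟩, fun a b => ?_⟩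
  obtain ⟨c, hac, hbc⟩ := hr₃ a.1 b.1
  obtain ⟨d, had, hbd⟩ := hs₃ a.2 b.2
  exact ⟨(c, d), ⟨hac, had⟩, ⟨hbc, hbd⟩⟩

theorem DownTo0.add {J K : Type uJ} {r : J → J → Prop} {s : K → K → Prop}
    {g : J → E} {h : K → E} (hg : DownTo0 r g) (hh : DownTo0 s h) :
    DownTo0 (fun p q : J × K => r p.1 q.1 ∧ s p.2 q.2) fun p => g p.1 + h p.2 := by
  refine ⟨fun p q hpq => add_le_add (hg.1 _ _ hpq.1) (hh.1 _ _ hpq.2), ?_, fun c hc => ?_⟩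
  · rintro _ ⟨p, rfl⟩
    exact add_nonneg (hg.nonneg _) (hh.nonneg _)
  · refine hh.2.2 ?_
    rintro _ ⟨k, rfl⟩
    refine sub_nonpos.mp (hg.2.2 ?_)
    rintro _ ⟨j, rfl⟩
    exact sub_le_iff_le_add.mpr (hc ⟨(j, k), rfl⟩)

/-- A family dominated eventually by the sums of eventual bounds of two collectively order
convergent families is collectively order convergent. -/
theorem CoOConv0.of_abs_le_add {A : Type uA} [Preorder A] [IsDirected A (· ≤ ·)]
    {B : Type uB} {C : Type uC} {D : Type uD} {x : B → A → E} {y : C → A → E} {z : D → A → E}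
    (hx : CoOConv0.{uJ} x) (hy : CoOConv0.{uJ} y)
    (hz : ∀ (α : A) (u v : E), 0 ≤ u → 0 ≤ v → (∀ b, |x b α| ≤ u) → (∀ c, |y c α| ≤ v) →
      ∀ d, |z d α| ≤ u + v) :
    CoOConv0.{uJ} z := by
  obtain ⟨J, r, g, hr, hg, hxg⟩ := hx
  obtain ⟨K, s, h, hs, hh, hyh⟩ := hy
  refine ⟨J × K, _, _, hr.prod hs, hg.add hh, fun p => ?_⟩
  obtain ⟨α₁, h₁⟩ := hxg p.1
  obtain ⟨α₂, h₂⟩ := hyh p.2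
  obtain ⟨α₀, h₁₀, h₂₀⟩ := exists_ge_ge α₁ α₂
  exact ⟨α₀, fun d α hα => hz α _ _ (hg.nonneg _) (hh.nonneg _)
    (fun b => h₁ b α (h₁₀.trans hα)) (fun c => h₂ c α (h₂₀.trans hα)) d⟩

end VectorLattice

/-- Unions and sums of two collectively uo-convergent (to `0`) families of
nets collectively uo-converge to `0`. -/
theorem coUoconv_union_and_sum
    {E : Type uE} [Lattice E] [AddCommGroup E] [CovariantClass E E (· + ·) (· ≤ ·)]
    [Module ℝ E] [PosSMulMono ℝ E]
    {A : Type uA} [Preorder A] [IsDirected A (· ≤ ·)] [Nonempty A]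
    {B : Type uB} [Nonempty B] {C : Type uB} [Nonempty C]
    (x : B → A → E) (y : C → A → E)
    (hx : CoUoConv0.{uJ} x) (hy : CoUoConv0.{uJ} y) :
    CoUoConv0.{uJ} (Sum.elim x y) ∧
      CoUoConv0.{uJ} (fun (p : B × C) (α : A) => x p.1 α + y p.2 α) := by
  have key (a w : E) (hw : 0 ≤ w) : |(|a| ⊓ w)| = |a| ⊓ w :=
    abs_of_nonneg (le_inf (abs_nonneg a) hw)
  refine ⟨fun w hw => (hx w hw).of_abs_le_add (hy w hw) fun α u v hu hv hxu hyv d => ?_,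
    fun w hw => (hx w hw).of_abs_le_add (hy w hw) fun α u v _ _ hxu hyv p => ?_⟩
  · cases d with
    | inl b => exact (hxu b).trans (le_add_of_nonneg_right hv)
    | inr c => exact (hyv c).trans (le_add_of_nonneg_left hu)
  · have hxu' := hxu p.1
    have hyv' := hyv p.2
    rw [key _ _ hw] at hxu' hyv' ⊢
    calc |x p.1 α + y p.2 α| ⊓ w ≤ (|x p.1 α| + |y p.2 α|) ⊓ w :=
          inf_le_inf_right w (abs_add_le _ _)
      _ ≤ |x p.1 α| ⊓ w + |y p.2 α| ⊓ w :=
          add_inf_le_inf_add_inf (abs_nonneg _) (abs_nonneg _) hw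
      _ ≤ u + v := add_le_add hxu' hyv'
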